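/- Let s₁, s₂ ≥ 2 be integers. Every triangle-free graph G of order at least 3 with σ₂(G) ≥ 2(s₁ + s₂) − 1 contains two vertex-disjoint induced subgraphs H₁ and H₂ such that σ₂(Hᵢ) ≥ 2sᵢ − 1 and |V(Hᵢ)| ≥ 2sᵢ for i = 1, 2. -/

import Mathlib

/-- Degree of `u` within the induced subgraph on the vertex set `A`. -/
def degIn {V : Type*} [Fintype V] [DecidableEq V] (G : SimpleGraph V)
    [DecidableRel G.Adj] (A : Finset V) (u : V) : ℕ :=
  (G.neighborFinset u ∩ A).card

section DegreeWithin

variable {V : Type*} [Fintype V] [DecidableEq V] (G : SimpleGraph V) [DecidableRel G.Adj]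

theorem degIn_mono {A B : Finset V} (h : A ⊆ B) (v : V) : degIn G A v ≤ degIn G B v :=
  Finset.card_le_card (Finset.inter_subset_inter_left h)

theorem degIn_add_sdiff {A S : Finset V} (h : A ⊆ S) (v : V) :
    degIn G A v + degIn G (S \ A) v = degIn G S v := by
  unfold degIn
  rw [← Finset.card_union_of_disjoint]
  · congr 1
    rw [← Finset.inter_union_distrib_left, Finset.union_sdiff_of_subset h]
  · exact Finset.disjoint_sdiff.mono Finset.inter_subset_right Finset.inter_subset_right

theorem degIn_univ (v : V) : degIn G Finset.univ v = G.degree v := by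
  simp [degIn]

theorem degIn_insert {A : Finset V} {v : V} (hv : v ∉ A) (x : V) :
    degIn G (insert v A) x = degIn G A x + if G.Adj v x then 1 else 0 := by
  unfold degIn
  split_ifs with h
  · rw [Finset.inter_insert_of_mem (by simpa using h.symm), Finset.card_insert_of_notMem]
    simp [hv]
  · rw [Finset.inter_insert_of_notMem (by simpa [G.adj_comm] using h), add_zero]

theorem degIn_erase {A : Finset V} {v : V} (hv : v ∈ A) (x : V) :
    degIn G (A.erase v) x + (if G.Adj v x then 1 else 0) = degIn G A x := by
  rw [← degIn_insert G (Finset.notMem_erase v A), Finset.insert_erase hv]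

theorem degIn_le_degIn_erase_add_one (A : Finset V) (v x : V) :
    degIn G A x ≤ degIn G (A.erase v) x + 1 := by
  by_cases hv : v ∈ A
  · have := degIn_erase G hv x
    split_ifs at this <;> omega
  · rw [Finset.erase_eq_of_notMem hv]
    omega

theorem degIn_erase_self (A : Finset V) (v : V) : degIn G (A.erase v) v = degIn G A v := by
  by_cases hv : v ∈ A
  · simpa using degIn_erase G hv v
  · rw [Finset.erase_eq_of_notMem hv]

theorem degIn_insert_self (A : Finset V) (v : V) : degIn G (insert v A) v = degIn G A v := by
  by_cases hv : v ∈ A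
  · rw [Finset.insert_eq_of_mem hv]
  · simpa using degIn_insert G hv v

/-- In a triangle-free graph, deleting two adjacent vertices lowers degrees by at most one. -/
theorem degIn_le_degIn_erase_erase_add_one {G : SimpleGraph V} [DecidableRel G.Adj]
    (htf : G.CliqueFree 3) {u v : V} (huv : G.Adj u v) (A : Finset V) (x : V) :
    degIn G A x ≤ degIn G ((A.erase u).erase v) x + 1 := by
  by_cases hu : G.Adj u x
  · have hv : ¬G.Adj v x := fun hv =>
      htf {u, v, x} (SimpleGraph.is3Clique_triple_iff.2 ⟨huv, hu, hv⟩)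
    have h1 := degIn_le_degIn_erase_add_one G A u x
    by_cases hvA : v ∈ A.erase u
    · have h2 := degIn_erase G hvA x
      rw [if_neg hv] at h2
      omega
    · rwa [Finset.erase_eq_of_notMem hvA]
  · have h1 := degIn_le_degIn_erase_add_one G (A.erase u) v x
    by_cases huA : u ∈ A
    · have h2 := degIn_erase G huA x
      rw [if_neg hu] at h2
      omega
    · rw [Finset.erase_eq_of_notMem huA] at h1 ⊢
      exact h1

theorem sum_degIn_insert {A : Finset V} {v : V} (hv : v ∉ A) :
    ∑ x ∈ insert v A, degIn G (insert v A) x = ∑ x ∈ A, degIn G A x + 2 * degIn G A v := by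
  rw [Finset.sum_insert hv, degIn_insert_self, Finset.sum_congr rfl
    (fun x _ => degIn_insert G hv x), Finset.sum_add_distrib]
  have : ∑ x ∈ A, (if G.Adj v x then 1 else 0) = degIn G A v := by
    rw [Finset.sum_boole, degIn]
    simp only [Nat.cast_id]
    congr 1
    ext x
    simp [and_comm]
  omega

/-- No nonempty subset of `A` induces a graph in which every vertex `v` has degree at least
`f v`. -/
def Meager (f : V → ℕ) (A : Finset V) : Prop :=
  ∀ X ⊆ A, X.Nonempty → ∃ v ∈ X, degIn G X v < f v

theorem not_meager_iff {f : V → ℕ} {A : Finset V} :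
    ¬Meager G f A ↔ ∃ X ⊆ A, X.Nonempty ∧ ∀ v ∈ X, f v ≤ degIn G X v := by
  simp [Meager]

/-- Twice the number of edges inside `A` plus the total weight `f` of `A`. -/
def degWeight (f : V → ℕ) (A : Finset V) : ℕ :=
  ∑ x ∈ A, degIn G A x + ∑ x ∈ A, f x

theorem degWeight_insert (f : V → ℕ) {A : Finset V} {v : V} (hv : v ∉ A) :
    degWeight G f (insert v A) = degWeight G f A + 2 * degIn G A v + f v := by
  rw [degWeight, degWeight, sum_degIn_insert G hv, Finset.sum_insert hv]
  omega

theorem degWeight_erase (f : V → ℕ) {A : Finset V} {v : V} (hv : v ∈ A) :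
    degWeight G f (A.erase v) + 2 * degIn G A v + f v = degWeight G f A := by
  have := degWeight_insert G f (Finset.notMem_erase v A)
  rw [Finset.insert_erase hv, degIn_erase_self] at this
  exact this.symm

variable {G}

theorem exists_meager_split {a b : V → ℕ} {S : Finset V} (hS : S.Nonempty)
    (h : ∀ v ∈ S, a v + b v ≤ degIn G S v)
    (hno : ∀ A B : Finset V, Disjoint A B → A.Nonempty → B.Nonempty →
      (∀ v ∈ A, a v ≤ degIn G A v) → ∃ v ∈ B, degIn G B v < b v) :
    ∃ A ⊆ S, Meager G (fun v => a v + 1) A ∧ Meager G b (S \ A) := by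
  classical
  let F := S.powerset.filter fun A => A.Nonempty ∧ ∀ v ∈ A, a v ≤ degIn G A v
  have hF : F.Nonempty := ⟨S, by
    simp only [F, Finset.mem_filter, Finset.mem_powerset]
    exact ⟨subset_rfl, hS, fun v hv => by have := h v hv; omega⟩⟩
  obtain ⟨A, hA, hmin⟩ := Finset.exists_min_image F Finset.card hF
  simp only [F, Finset.mem_filter, Finset.mem_powerset] at hA hmin
  obtain ⟨hAS, hAne, hAgood⟩ := hA
  refine ⟨A, hAS, ?_, ?_⟩
  · by_contra hm
    obtain ⟨X, hXA, ⟨x, hx⟩, hX⟩ := (not_meager_iff G).1 hm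
    have hne : (X.erase x).Nonempty := by
      have h1 := hX x hx
      rw [← degIn_erase_self] at h1
      obtain ⟨y, hy⟩ := Finset.card_pos.1 (show 0 < degIn G (X.erase x) x by omega)
      exact ⟨y, (Finset.mem_inter.1 hy).2⟩
    have := hmin (X.erase x) ⟨(Finset.erase_subset _ _).trans (hXA.trans hAS), hne,
      fun v hv => by
        have h1 := hX v (Finset.mem_of_mem_erase hv)
        have h2 := degIn_le_degIn_erase_add_one G X x v
        omega⟩
    have h3 := Finset.card_erase_lt_of_mem hx
    have h4 := Finset.card_le_card hXA
    omega
  · intro X hX hXne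
    exact hno A X (Finset.disjoint_sdiff.mono_right hX) hAne hXne hAgood

/-- Kaneko's decomposition theorem for triangle-free graphs, with variable degree bounds. -/
theorem exists_disjoint_degIn_ge (htf : G.CliqueFree 3) {a b : V → ℕ} {S : Finset V}
    (hS : S.Nonempty) (ha : ∀ v ∈ S, 1 ≤ a v) (hb : ∀ v ∈ S, 1 ≤ b v)
    (h : ∀ v ∈ S, a v + b v ≤ degIn G S v) :
    ∃ A B : Finset V, Disjoint A B ∧ A.Nonempty ∧ B.Nonempty ∧
      (∀ v ∈ A, a v ≤ degIn G A v) ∧ ∀ v ∈ B, b v ≤ degIn G B v := by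
  classical
  by_contra! hno
  let F := S.powerset.filter fun A => Meager G (fun v => a v + 1) A ∧ Meager G b (S \ A)
  let μ : Finset V → ℕ := fun A =>
    degWeight G (fun v => 2 * b v) A + degWeight G (fun v => 2 * a v + 1) (S \ A)
  have hF : F.Nonempty := by
    obtain ⟨A, hAS, h1, h2⟩ := exists_meager_split hS h hno
    exact ⟨A, by simp [F, hAS, h1, h2]⟩
  obtain ⟨A, hA, hmax⟩ := Finset.exists_max_image F μ hF
  simp only [F, Finset.mem_filter, Finset.mem_powerset, μ] at hA hmax
  obtain ⟨hAS, hAm, hBm⟩ := hA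
  have hAne : A.Nonempty := by
    by_contra hA
    rw [Finset.not_nonempty_iff_eq_empty] at hA
    subst hA
    obtain ⟨v, hv, hlt⟩ := hBm S (by simp) hS
    have := h v hv
    omega
  have hBne : (S \ A).Nonempty := by
    by_contra hB
    rw [Finset.not_nonempty_iff_eq_empty, Finset.sdiff_eq_empty_iff_subset] at hB
    obtain ⟨v, hv, hlt⟩ := hAm S hB hS
    dsimp only at hlt
    have := h v hv
    have := hb v hv
    omega
  obtain ⟨v, hvA, hvlt⟩ := hAm A subset_rfl hAne
  dsimp only at hvlt
  obtain ⟨u, huB, hult⟩ := hBm _ subset_rfl hBne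
  have huS : u ∈ S := (Finset.mem_sdiff.1 huB).1
  have huA : u ∉ A := (Finset.mem_sdiff.1 huB).2
  have hvB : v ∉ S \ A := fun hv => (Finset.mem_sdiff.1 hv).2 hvA
  have hv_split := degIn_add_sdiff G hAS v
  have hu_split := degIn_add_sdiff G hAS u
  have hv_deg := h v (hAS hvA)
  have hu_deg := h u huS
  have hB_insert : S \ A.erase v = insert v (S \ A) := Finset.sdiff_erase (hAS hvA)
  have hB_erase : S \ insert u A = (S \ A).erase u := Finset.sdiff_insert S A u
  have hBv : ¬Meager G b (insert v (S \ A)) := by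
    intro hm
    have h1 := hmax (A.erase v) ⟨(Finset.erase_subset _ _).trans hAS,
      fun X hX => hAm X (hX.trans (Finset.erase_subset _ _)), by rwa [hB_insert]⟩
    have h2 := degWeight_erase G (fun v => 2 * b v) hvA
    have h3 := degWeight_insert G (fun v => 2 * a v + 1) hvB
    rw [hB_insert] at h1
    omega
  have hAu : ¬Meager G (fun v => a v + 1) (insert u A) := by
    intro hm
    have h1 := hmax (insert u A) ⟨Finset.insert_subset huS hAS, hm, by
      rw [hB_erase]
      exact fun X hX => hBm X (hX.trans (Finset.erase_subset _ _))⟩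
    have h2 := degWeight_insert G (fun v => 2 * b v) huA
    have h3 := degWeight_erase G (fun v => 2 * a v + 1) huB
    rw [hB_erase] at h1
    omega
  obtain ⟨B', hB'sub, hB'ne, hB'⟩ := (not_meager_iff G).1 hBv
  obtain ⟨A', hA'sub, ⟨y, hy⟩, hA'⟩ := (not_meager_iff G).1 hAu
  have huA' : u ∈ A' := by
    by_contra hu
    have hsub : A' ⊆ A := fun x hx =>
      (Finset.mem_insert.1 (hA'sub hx)).resolve_left (fun e => hu (e ▸ hx))
    obtain ⟨x, hx, hlt⟩ := hAm A' hsub ⟨y, hy⟩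
    dsimp only at hlt
    have := hA' x hx
    omega
  have hu2 : 2 ≤ degIn G A' u := by
    have h1 := hA' u huA'
    have h2 := ha u huS
    omega
  by_cases huv : G.Adj u v
  · have hdisj : Disjoint ((A'.erase u).erase v) B' := by
      rw [Finset.disjoint_left]
      intro x hx hxB
      simp only [Finset.mem_erase] at hx
      have h1 := Finset.mem_insert.1 (hA'sub hx.2.2)
      have h2 := Finset.mem_insert.1 (hB'sub hxB)
      simp only [Finset.mem_sdiff] at h2
      tauto
    have hne : ((A'.erase u).erase v).Nonempty := by
      have h1 := degIn_le_degIn_erase_erase_add_one htf huv A' u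
      obtain ⟨z, hz⟩ := Finset.card_pos.1 (show 0 < degIn G ((A'.erase u).erase v) u by omega)
      exact ⟨z, (Finset.mem_inter.1 hz).2⟩
    obtain ⟨x, hx, hlt⟩ := hno _ B' hdisj hne hB'ne (fun x hx => by
      have h1 := hA' x (Finset.mem_of_mem_erase (Finset.mem_of_mem_erase hx))
      have h2 := degIn_le_degIn_erase_erase_add_one htf huv A' x
      omega)
    have := hB' x hx
    omega
  · have huB' : u ∉ B' := by
      intro hu
      have h1 := hB' u hu
      have h2 := degIn_mono G hB'sub u
      rw [degIn_insert G hvB, if_neg (fun e => huv e.symm)] at h2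
      omega
    have hdisj : Disjoint (A'.erase v) B' := by
      rw [Finset.disjoint_left]
      intro x hx hxB
      simp only [Finset.mem_erase] at hx
      have h1 := Finset.mem_insert.1 (hA'sub hx.2)
      have h2 := Finset.mem_insert.1 (hB'sub hxB)
      simp only [Finset.mem_sdiff] at h2
      have h3 : x ≠ u := fun e => huB' (e ▸ hxB)
      tauto
    have hne : (A'.erase v).Nonempty :=
      ⟨u, Finset.mem_erase.2 ⟨fun e => huA (e ▸ hvA), huA'⟩⟩
    obtain ⟨x, hx, hlt⟩ := hno _ B' hdisj hne hB'ne (fun x hx => by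
      have h1 := hA' x (Finset.mem_of_mem_erase hx)
      have h2 := degIn_le_degIn_erase_add_one G A' v x
      omega)
    have := hB' x hx
    omega

variable (G)

/-- The subgraph induced on `A` has order at least `2 * s` and satisfies `σ₂ ≥ 2 * s - 1`. -/
def OreGood (s : ℕ) (A : Finset V) : Prop :=
  (∀ u ∈ A, ∀ v ∈ A, u ≠ v → ¬G.Adj u v → 2 * s - 1 ≤ degIn G A u + degIn G A v) ∧
    2 * s ≤ A.card

variable {G}

theorem two_mul_le_card_of_adj (htf : G.CliqueFree 3) {A : Finset V} {s : ℕ} {u v : V}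
    (huv : G.Adj u v) (hu : s ≤ degIn G A u) (hv : s ≤ degIn G A v) : 2 * s ≤ A.card := by
  have hdisj : Disjoint (G.neighborFinset u ∩ A) (G.neighborFinset v ∩ A) := by
    rw [Finset.disjoint_left]
    intro x hx hx'
    simp only [Finset.mem_inter, SimpleGraph.mem_neighborFinset] at hx hx'
    exact htf {u, v, x} (SimpleGraph.is3Clique_triple_iff.2 ⟨huv, hx.1, hx'.1⟩)
  have h1 := Finset.card_le_card
    (Finset.union_subset (Finset.inter_subset_right (s₁ := G.neighborFinset u) (s₂ := A))
      (Finset.inter_subset_right (s₁ := G.neighborFinset v) (s₂ := A)))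
  rw [Finset.card_union_of_disjoint hdisj] at h1
  unfold degIn at hu hv
  omega

theorem oreGood_of_forall_ne (htf : G.CliqueFree 3) {A : Finset V} {s : ℕ} (hs : 2 ≤ s)
    (hA : A.Nonempty) (x : V) (hx : x ∈ A → 1 ≤ degIn G A x)
    (hdeg : ∀ v ∈ A, v ≠ x → s ≤ degIn G A v)
    (hsum : ∀ v ∈ A, x ∈ A → v ≠ x → ¬G.Adj x v → 2 * s - 1 ≤ degIn G A x + degIn G A v) :
    OreGood G s A := by
  constructor
  · intro u hu v hv huv hadj
    by_cases hux : u = x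
    · subst hux
      exact hsum v hv hu huv.symm hadj
    by_cases hvx : v = x
    · subst hvx
      rw [add_comm]
      exact hsum u hu hv huv (fun e => hadj e.symm)
    have h1 := hdeg u hu hux
    have h2 := hdeg v hv hvx
    omega
  · obtain ⟨y, hyA, hyx⟩ : ∃ y ∈ A, y ≠ x := by
      obtain ⟨y, hy⟩ := hA
      by_cases hyx : y = x
      · subst hyx
        obtain ⟨z, hz⟩ := Finset.card_pos.1 (hx hy)
        simp only [Finset.mem_inter, SimpleGraph.mem_neighborFinset] at hz
        exact ⟨z, hz.2, hz.1.ne'⟩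
      · exact ⟨y, hy, hyx⟩
    have hy := hdeg y hyA hyx
    have hcard : 1 < (G.neighborFinset y ∩ A).card := lt_of_lt_of_le hs hy
    obtain ⟨z, hz, hzx⟩ := Finset.exists_mem_ne hcard x
    simp only [Finset.mem_inter, SimpleGraph.mem_neighborFinset] at hz
    exact two_mul_le_card_of_adj htf hz.1 hy (hdeg z hz.2 hzx)

theorem oreGood_of_forall_ne_of_pred_le (htf : G.CliqueFree 3) {A : Finset V} {s : ℕ}
    (hs : 2 ≤ s) (hA : A.Nonempty) (x : V) (hx : x ∈ A → s - 1 ≤ degIn G A x)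
    (hdeg : ∀ v ∈ A, v ≠ x → s ≤ degIn G A v) : OreGood G s A :=
  oreGood_of_forall_ne htf hs hA x (fun h => by have := hx h; omega) hdeg
    fun v hv hxA hvx _ => by
      have h1 := hx hxA
      have h2 := hdeg v hv hvx
      omega

theorem exists_oreGood_of_degIn_ge (htf : G.CliqueFree 3) {s₁ s₂ : ℕ} (hs₁ : 2 ≤ s₁)
    (hs₂ : 2 ≤ s₂) {S : Finset V} (hS : S.Nonempty) (x : V)
    (hx : x ∈ S → s₁ + s₂ - 2 ≤ degIn G S x)
    (hdeg : ∀ v ∈ S, v ≠ x → s₁ + s₂ ≤ degIn G S v) :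
    ∃ A B : Finset V, Disjoint A B ∧ OreGood G s₁ A ∧ OreGood G s₂ B := by
  obtain ⟨A, B, hAB, hA, hB, h1, h2⟩ := exists_disjoint_degIn_ge htf
    (a := fun v => if v = x then s₁ - 1 else s₁) (b := fun v => if v = x then s₂ - 1 else s₂) hS
    (fun v _ => by split_ifs <;> omega) (fun v _ => by split_ifs <;> omega)
    (fun v hv => by
      by_cases hvx : v = x
      · subst hvx
        have := hx hv
        simp only [if_true]
        omega
      · simpa [hvx] using hdeg v hv hvx)
  refine ⟨A, B, hAB, ?_, ?_⟩
  · exact oreGood_of_forall_ne_of_pred_le htf hs₁ hA x (fun h => by simpa using h1 x h)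
      fun v hv hvx => by simpa [hvx] using h1 v hv
  · exact oreGood_of_forall_ne_of_pred_le htf hs₂ hB x (fun h => by simpa using h2 x h)
      fun v hv hvx => by simpa [hvx] using h2 v hv

theorem exists_oreGood_of_lt_degree (htf : G.CliqueFree 3) {s₁ s₂ : ℕ} (hs₁ : 2 ≤ s₁)
    (hs₂ : 2 ≤ s₂)
    (hσ : ∀ u v : V, u ≠ v → ¬G.Adj u v → 2 * (s₁ + s₂) - 1 ≤ G.degree u + G.degree v)
    {w : V} (hw : G.degree w < s₁ + s₂) (hw' : s₂ < G.degree w)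
    (hpred : ∀ v, v ≠ w → s₁ + s₂ - 1 ≤ G.degree v) :
    ∃ A B : Finset V, Disjoint A B ∧ OreGood G s₁ A ∧ OreGood G s₂ B := by
  obtain ⟨x, hx⟩ : ∃ x, ∀ v, v ≠ w → v ≠ x → s₁ + s₂ ≤ G.degree v := by
    by_cases hex : ∃ x, x ≠ w ∧ G.degree x < s₁ + s₂
    · obtain ⟨x, hxw, hx⟩ := hex
      refine ⟨x, fun v hvw hvx => ?_⟩
      by_contra! hv
      have hlow : ∀ y z : V, y ≠ z → G.degree y < s₁ + s₂ → G.degree z < s₁ + s₂ →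
          G.Adj y z := by
        intro y z hyz hy hz
        by_contra hadj
        have := hσ y z hyz hadj
        omega
      exact htf {v, w, x} (SimpleGraph.is3Clique_triple_iff.2
        ⟨hlow v w hvw hv hw, hlow v x hvx hv hx, hlow w x hxw.symm hw hx⟩)
    · push Not at hex
      exact ⟨w, fun v hv _ => hex v hv⟩
  obtain ⟨A, B, hAB, hA, hB, h1, h2⟩ := exists_disjoint_degIn_ge htf (S := Finset.univ)
    (a := fun v => if v = w then G.degree w - s₂ else if G.Adj w v then s₁ else
      2 * s₁ + s₂ - 1 - G.degree w)
    (b := fun v => if v = w then s₂ else if v = x then s₂ - 1 else s₂) ⟨w, Finset.mem_univ w⟩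
    (fun v _ => by split_ifs <;> omega)
    (fun v _ => by split_ifs <;> omega)
    (fun v _ => by
      rw [degIn_univ]
      by_cases hvw : v = w
      · subst hvw
        simp only [if_true]
        omega
      have h3 := hpred v hvw
      have h4 := hx v hvw
      have h5 := hσ w v (Ne.symm hvw)
      simp only [hvw, if_false]
      split_ifs with hadj hvx hvx
      · omega
      · have := h4 hvx
        omega
      · have := h5 hadj
        omega
      · have := h5 hadj
        omega)
  refine ⟨A, B, hAB, ?_, ?_⟩
  · refine oreGood_of_forall_ne htf hs₁ hA w (fun hwA => ?_) (fun v hv hvw => ?_)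
      fun v hv hwA hvw hadj => ?_
    · have := h1 w hwA
      rw [if_pos rfl] at this
      omega
    · have := h1 v hv
      rw [if_neg hvw] at this
      split_ifs at this <;> omega
    · have h3 := h1 w hwA
      have h4 := h1 v hv
      rw [if_pos rfl] at h3
      rw [if_neg hvw, if_neg hadj] at h4
      omega
  · refine oreGood_of_forall_ne_of_pred_le htf hs₂ hB x (fun hxB => ?_) fun v hv hvx => ?_
    · have := h2 x hxB
      split_ifs at this <;> omega
    · have := h2 v hv
      simpa [hvx] using this

end DegreeWithin

theorem stmt_6 {V : Type*} [Fintype V] [DecidableEq V]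
    (G : SimpleGraph V) [DecidableRel G.Adj] (s₁ s₂ : ℕ) (hs₁ : 2 ≤ s₁) (hs₂ : 2 ≤ s₂)
    (htf : G.CliqueFree 3) (hcard : 3 ≤ Fintype.card V)
    (hσ : ∀ u v : V, u ≠ v → ¬G.Adj u v →
      2 * (s₁ + s₂) - 1 ≤ G.degree u + G.degree v) :
    ∃ A₁ A₂ : Finset V, Disjoint A₁ A₂ ∧
      (∀ u ∈ A₁, ∀ v ∈ A₁, u ≠ v → ¬G.Adj u v →
        2 * s₁ - 1 ≤ degIn G A₁ u + degIn G A₁ v) ∧ 2 * s₁ ≤ A₁.card ∧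
      (∀ u ∈ A₂, ∀ v ∈ A₂, u ≠ v → ¬G.Adj u v →
        2 * s₂ - 1 ≤ degIn G A₂ u + degIn G A₂ v) ∧ 2 * s₂ ≤ A₂.card := by
  suffices hgoal : ∃ A B : Finset V, Disjoint A B ∧ OreGood G s₁ A ∧ OreGood G s₂ B by
    obtain ⟨A, B, hAB, hA, hB⟩ := hgoal
    exact ⟨A, B, hAB, hA.1, hA.2, hB.1, hB.2⟩
  have hne : (Finset.univ : Finset V).Nonempty := by
    rw [← Finset.card_pos, Finset.card_univ]
    omega
  obtain ⟨w, -, hmin⟩ := Finset.exists_min_image Finset.univ (fun v => G.degree v) hne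
  by_cases hw : s₁ + s₂ ≤ G.degree w
  · have hdeg : ∀ v, s₁ + s₂ ≤ degIn G Finset.univ v := fun v => by
      rw [degIn_univ]
      exact hw.trans (hmin v (Finset.mem_univ v))
    exact exists_oreGood_of_degIn_ge htf hs₁ hs₂ hne w
      (fun _ => (Nat.sub_le _ _).trans (hdeg w)) fun v _ _ => hdeg v
  push Not at hw
  have herase_ne : ∀ x, ((Finset.univ.erase w).erase x).Nonempty := fun x => by
    rw [← Finset.card_pos]
    have h1 := Finset.pred_card_le_card_erase (s := Finset.univ) (a := w)
    have h2 := Finset.pred_card_le_card_erase (s := Finset.univ.erase w) (a := x)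
    rw [Finset.card_univ] at h1
    omega
  by_cases hpair : ∃ x, G.Adj w x ∧ G.degree x ≤ s₁ + s₂ - 2
  · obtain ⟨x, hwx, hx⟩ := hpair
    have hwmin := hmin x (Finset.mem_univ x)
    refine exists_oreGood_of_degIn_ge htf hs₁ hs₂ (herase_ne x) w (by simp) fun v hv hvw => ?_
    simp only [Finset.mem_erase] at hv
    have h1 := degIn_le_degIn_erase_erase_add_one htf hwx Finset.univ v
    rw [degIn_univ] at h1
    by_cases hwv : G.Adj w v
    · have hxv : ¬G.Adj x v := fun hxv =>
        htf {w, x, v} (SimpleGraph.is3Clique_triple_iff.2 ⟨hwx, hwv, hxv⟩)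
      have := hσ x v (Ne.symm hv.1) hxv
      omega
    · have := hσ w v (Ne.symm hvw) hwv
      omega
  push Not at hpair
  have hpred : ∀ v, v ≠ w → s₁ + s₂ - 1 ≤ G.degree v := fun v hvw => by
    by_cases hwv : G.Adj w v
    · have := hpair v hwv
      omega
    · have := hσ w v (Ne.symm hvw) hwv
      omega
  by_cases hhalf : s₁ + s₂ < 2 * G.degree w
  · by_cases hlt : s₂ < G.degree w
    · exact exists_oreGood_of_lt_degree htf hs₁ hs₂ hσ hw hlt hpred
    · obtain ⟨A, B, hAB, hA, hB⟩ := exists_oreGood_of_lt_degree (s₁ := s₂) (s₂ := s₁) htf hs₂ hs₁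
        (by rwa [add_comm s₂ s₁]) (w := w) (by omega) (by omega) (by rwa [add_comm s₂ s₁])
      exact ⟨B, A, hAB.symm, hB, hA⟩
  rcases Nat.eq_zero_or_pos (G.degree w) with hzero | hpos
  · refine exists_oreGood_of_degIn_ge htf hs₁ hs₂ ((herase_ne w).mono (Finset.erase_subset _ _)) w
      (by simp) fun v hv hvw => ?_
    have hadj : ¬G.Adj w v := fun hadj => by
      have := (G.degree_pos_iff_exists_adj w).2 ⟨v, hadj⟩
      omega
    have h1 := hσ w v (Ne.symm hvw) hadj
    have h2 := degIn_le_degIn_erase_add_one G Finset.univ w v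
    rw [degIn_univ] at h2
    omega
  · obtain ⟨x, hwx⟩ := (G.degree_pos_iff_exists_adj w).1 hpos
    set T := (G.neighborFinset w).erase x with hT
    set S := (Finset.univ \ T).erase w with hS
    have hwT : w ∈ Finset.univ \ T := by simp [hT]
    have hTcard : T.card = G.degree w - 1 := by
      rw [hT, Finset.card_erase_of_mem (by simpa using hwx),
        SimpleGraph.card_neighborFinset_eq_degree]
    refine exists_oreGood_of_degIn_ge htf hs₁ hs₂ (S := S) ⟨x, by simp [hS, hT, hwx.ne']⟩ x
      (fun _ => ?_) fun v hv hvx => ?_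
    · have h1 := degIn_add_sdiff G (Finset.subset_univ T) x
      have h2 := degIn_le_degIn_erase_add_one G (Finset.univ \ T) w x
      rw [← hS] at h2
      have h3 : degIn G T x = 0 := by
        rw [degIn, Finset.card_eq_zero, ← Finset.disjoint_iff_inter_eq_empty,
          Finset.disjoint_left]
        intro y hy hyT
        simp only [hT, Finset.mem_erase, SimpleGraph.mem_neighborFinset] at hy hyT
        exact htf {w, x, y} (SimpleGraph.is3Clique_triple_iff.2 ⟨hwx, hyT.2, hy⟩)
      have h4 := hpair x hwx
      rw [degIn_univ] at h1
      omega
    · simp only [hS, hT, Finset.mem_erase, Finset.mem_sdiff, Finset.mem_univ, true_and,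
        SimpleGraph.mem_neighborFinset, not_and] at hv
      have hwv : ¬G.Adj w v := hv.2 hvx
      have h1 := degIn_add_sdiff G (Finset.subset_univ T) v
      have h2 := degIn_erase G hwT v
      have h3 : degIn G T v ≤ T.card := Finset.card_le_card Finset.inter_subset_right
      have h4 := hσ w v (Ne.symm hv.1) hwv
      rw [degIn_univ] at h1
      rw [if_neg hwv, ← hS] at h2
      omega
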